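/- arXiv:2507.22597 — 2 statements merged into one kernel-verified Lean document; each statement's English description precedes it below -/
import Mathlib

section
/- Let q be a prime power and let w = (w_0, w_1, …, w_m) be a weight vector with 1 = w_0 ≤ w_1 = ⋯ = w_ℓ < w_{ℓ+1} ≤ ⋯ ≤ w_m and 1 ≤ ℓ ≤ m−1. Then for every integer d ≥ 1, e_q(d; 1, w_1, …, w_m) = min{ p_m, (⌊(d−1)/w_1⌋ + 1)·q^{m−1} + p_{m−2} }. -/
open MvPolynomial

noncomputable section

/-- `pSum q k = 1 + q + ⋯ + q^(k-1)`; so `p_m = pSum q (m+1)`. -/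
def pSum (q k : ℕ) : ℕ := ∑ i ∈ Finset.range k, q ^ i

/-- Equivalence of nonzero vectors under weighted scaling by the algebraic closure. -/
def wRel (F : Type) [Field F] {m : ℕ} (w : Fin (m + 1) → ℕ)
    (x y : {v : Fin (m + 1) → AlgebraicClosure F // v ≠ 0}) : Prop :=
  ∃ lam : (AlgebraicClosure F)ˣ, ∀ i, y.1 i = (lam : AlgebraicClosure F) ^ w i * x.1 i

/-- The weighted projective space `ℙ(w)` as set of orbits. -/
def PW (F : Type) [Field F] {m : ℕ} (w : Fin (m + 1) → ℕ) : Type :=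
  Quot (wRel F w)

def PW.mk (F : Type) [Field F] {m : ℕ} (w : Fin (m + 1) → ℕ)
    (x : {v : Fin (m + 1) → AlgebraicClosure F // v ≠ 0}) : PW F w :=
  Quot.mk _ x

/-- The `𝔽_q`-rational points of `ℙ(w)`: orbits fixed by coordinatewise Frobenius. -/
def ratPts (F : Type) [Field F] [Fintype F] {m : ℕ} (w : Fin (m + 1) → ℕ) :
    Set (PW F w) :=
  {c | ∃ x : {v : Fin (m + 1) → AlgebraicClosure F // v ≠ 0},
    PW.mk F w x = c ∧
    ∃ h : (fun i => x.1 i ^ Fintype.card F) ≠ (0 : Fin (m + 1) → AlgebraicClosure F),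
      PW.mk F w ⟨fun i => x.1 i ^ Fintype.card F, h⟩ = c}

/-- `V_{ℙ(w)}(f)(𝔽_q)`: the rational points at which `f` vanishes. -/
def vanishSet (F : Type) [Field F] [Fintype F] {m : ℕ} (w : Fin (m + 1) → ℕ)
    (f : MvPolynomial (Fin (m + 1)) F) : Set (PW F w) :=
  {c | c ∈ ratPts F w ∧ ∀ x, PW.mk F w x = c →
    MvPolynomial.eval x.1 (MvPolynomial.map (algebraMap F (AlgebraicClosure F)) f) = 0}

/-- `e_q(d; w)`: the maximal number of rational zeroes of a nonzero
weighted homogeneous polynomial of degree `d`. -/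
def eMax (F : Type) [Field F] [Fintype F] {m : ℕ} (w : Fin (m + 1) → ℕ) (d : ℕ) : ℕ :=
  sSup {n | ∃ f : MvPolynomial (Fin (m + 1)) F,
    f ≠ 0 ∧ MvPolynomial.IsWeightedHomogeneous w f d ∧ n = (vanishSet F w f).ncard}

/-- weighted degree of a monomial (exponent vector). -/
def wdeg {m : ℕ} (w : Fin (m + 1) → ℕ) (a : Fin (m + 1) →₀ ℕ) : ℕ := ∑ i, w i * a i

/-- degree-lexicographic order (weighted degree first, `x_0 < x_1 < ⋯ < x_m`). -/
def dlexLt {m : ℕ} (w : Fin (m + 1) → ℕ) (a b : Fin (m + 1) →₀ ℕ) : Prop :=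
  wdeg w a < wdeg w b ∨
    (wdeg w a = wdeg w b ∧ ∃ i, a i < b i ∧ ∀ j, i < j → a j = b j)

/-- `a` is the initial monomial of `f` for the weighted deglex order. -/
def IsInitial (F : Type) [Field F] {m : ℕ} (w : Fin (m + 1) → ℕ)
    (f : MvPolynomial (Fin (m + 1)) F) (a : Fin (m + 1) →₀ ℕ) : Prop :=
  a ∈ f.support ∧ ∀ b ∈ f.support, b ≠ a → dlexLt w b a

/-- The vanishing ideal `I(ℙ(w)(𝔽_q))`, generated by the homogeneous polynomials
vanishing at every rational point. -/
def vanishingIdeal (F : Type) [Field F] [Fintype F] {m : ℕ} (w : Fin (m + 1) → ℕ) :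
    Ideal (MvPolynomial (Fin (m + 1)) F) :=
  Ideal.span {g | (∃ e, MvPolynomial.IsWeightedHomogeneous w g e) ∧
    ∀ c ∈ ratPts F w, ∀ x, PW.mk F w x = c →
      MvPolynomial.eval x.1 (MvPolynomial.map (algebraMap F (AlgebraicClosure F)) g) = 0}

/-- `M̄`: monomials divisible by no initial monomial of a nonzero homogeneous
element of the vanishing ideal. -/
def Mbar (F : Type) [Field F] [Fintype F] {m : ℕ} (w : Fin (m + 1) → ℕ) :
    Set (Fin (m + 1) →₀ ℕ) :=
  {a | ¬ ∃ g : MvPolynomial (Fin (m + 1)) F, g ≠ 0 ∧ g ∈ vanishingIdeal F w ∧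
    (∃ e, MvPolynomial.IsWeightedHomogeneous w g e) ∧ ∃ b, IsInitial F w g b ∧ b ≤ a}

/-- `M̄_d`. -/
def MbarD (F : Type) [Field F] [Fintype F] {m : ℕ} (w : Fin (m + 1) → ℕ) (d : ℕ) :
    Set (Fin (m + 1) →₀ ℕ) :=
  {a ∈ Mbar F w | wdeg w a = d}

/-- `M̄_{d,i}`. -/
def MbarDI (F : Type) [Field F] [Fintype F] {m : ℕ} (w : Fin (m + 1) → ℕ) (d : ℕ)
    (i : Fin (m + 1)) : Set (Fin (m + 1) →₀ ℕ) :=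
  {a ∈ MbarD F w d | (∀ t, t < i → a t = 0) ∧ 1 ≤ a i}

/-- The regularity set `reg(ℙ(w)(𝔽_q)) = {d ≥ 1 : |M̄_d| = p_m}`. -/
def regSet (F : Type) [Field F] [Fintype F] {m : ℕ} (w : Fin (m + 1) → ℕ) : Set ℕ :=
  {d | 1 ≤ d ∧ (MbarD F w d).ncard = pSum (Fintype.card F) (m + 1)}

/-- Footprint bound at level `dtil`: number of monomials of `M̄_{dtil}` divisible by `a`. -/
def FB (F : Type) [Field F] [Fintype F] {m : ℕ} (w : Fin (m + 1) → ℕ) (dtil : ℕ)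
    (a : Fin (m + 1) →₀ ℕ) : ℕ :=
  {b | b ∈ MbarD F w dtil ∧ a ≤ b}.ncard

/-- `FB_i`: number of monomials of `M̄_{dtil, i}` divisible by `a`. -/
def FBi (F : Type) [Field F] [Fintype F] {m : ℕ} (w : Fin (m + 1) → ℕ) (dtil : ℕ)
    (i : Fin (m + 1)) (a : Fin (m + 1) →₀ ℕ) : ℕ :=
  {b | b ∈ MbarDI F w dtil i ∧ a ≤ b}.ncard

/-- Hilbert function of `𝔽_q[x]/I(ℙ(w)(𝔽_q))` at degree `d`. -/
def hilb (F : Type) [Field F] [Fintype F] {m : ℕ} (w : Fin (m + 1) → ℕ) (d : ℕ) : ℕ :=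
  Module.finrank F
    (↥(weightedHomogeneousSubmodule F w d) ⧸
      (Submodule.comap (weightedHomogeneousSubmodule F w d).subtype
        (Submodule.restrictScalars F (vanishingIdeal F w))))

/-- Denumerant: the number of representations `d = w0*i0 + w1*i1`. -/
def den (w0 w1 d : ℕ) : ℕ := {p : ℕ × ℕ | w0 * p.1 + w1 * p.2 = d}.ncard


/-- number of affine zeros -/
def zc {F : Type} [Field F] [Fintype F] {n : ℕ} (f : MvPolynomial (Fin n) F) : ℕ :=
  Nat.card {x : Fin n → F // eval x f = 0}

theorem arith_peel (q n e D D' M N : ℕ) (hq : 2 ≤ q) (he : e ≤ q) (hD' : 1 ≤ D') (hDD : D' + e ≤ D)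
    (hDq : D ≤ q) (hM : q * M ≤ q ^ n * (D' * (q - 1) + 1))
    (hN : N + M * e ≤ q ^ (n + 1) * e + q * M) :
    q * N ≤ q ^ (n + 1) * (D * (q - 1) + 1) := by
  obtain ⟨r, rfl⟩ : ∃ r, q = r + 1 := ⟨q - 1, by omega⟩
  obtain ⟨s, hs⟩ : ∃ s, r + 1 = e + s := ⟨r + 1 - e, by omega⟩
  obtain ⟨u, rfl⟩ : ∃ u, D = D' + e + u := ⟨D - D' - e, by omega⟩
  obtain ⟨v, rfl⟩ : ∃ v, D' = v + 1 := ⟨D' - 1, by omega⟩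
  simp only [Nat.add_sub_cancel] at *
  have h1 : N ≤ (r+1)^(n+1) * e + s * M := by
    have : (r+1) * M = e * M + s * M := by rw [hs]; ring
    nlinarith
  have h2 : (r+1) * N ≤ (r+1)^(n+2) * e + s * ((r+1)^n * ((v+1) * r + 1)) := by
    calc (r+1) * N ≤ (r+1) * ((r+1)^(n+1) * e + s * M) := Nat.mul_le_mul_left _ h1
      _ = (r+1)^(n+2) * e + s * ((r+1) * M) := by ring
      _ ≤ _ := by gcongr
  refine h2.trans ?_
  have : (r+1)^(n+2) * e + s * ((r+1)^n * ((v+1) * r + 1)) = (r+1)^n * ((r+1)^2 * e + s * ((v+1)*r+1)) := by ring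
  rw [this, pow_succ (r+1) n, mul_assoc ((r+1)^n)]
  apply Nat.mul_le_mul_left
  have hs' : (r:ℤ) + 1 = e + s := by exact_mod_cast hs
  zify
  have : (s:ℤ) = r + 1 - e := by linarith
  rw [this]
  have e1 : ((r:ℤ)+1) * ((v + 1 + e + u) * r + 1) - ((r+1)^2 * e + (r + 1 - e) * ((v+1)*r+1)) = e * r * v + (r+1) * u * r := by ring
  have : (0:ℤ) ≤ e * r * v + (r+1) * u * r := by positivity
  linarith

theorem zc_le {F : Type} [Field F] [Fintype F] {n : ℕ} (f : MvPolynomial (Fin n) F) :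
    zc f ≤ Fintype.card F ^ n := by
  unfold zc
  refine (Nat.card_le_card_of_injective _ Subtype.val_injective).trans ?_
  simp

theorem peel {F : Type} [Field F] [Fintype F] {n : ℕ} (f : MvPolynomial (Fin (n+1)) F) :
    zc f + zc (finSuccEquiv F n f).leadingCoeff * (finSuccEquiv F n f).natDegree ≤
      Fintype.card F ^ n * (finSuccEquiv F n f).natDegree +
        Fintype.card F * zc (finSuccEquiv F n f).leadingCoeff := by
  classical
  set P := finSuccEquiv F n f with hP
  set e := P.natDegree with he
  set c := P.leadingCoeff with hc
  have h1 : zc f = ∑ y : Fin n → F, Nat.card {t : F // eval (Fin.cons t y : Fin (n+1) → F) f = 0} := by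
    unfold zc
    rw [← Nat.card_sigma]
    refine Nat.card_congr ?_
    refine ⟨fun x => ⟨fun i => x.1 i.succ, ⟨x.1 0, ?_⟩⟩, fun x => ⟨Fin.cons x.2.1 x.1, x.2.2⟩, ?_, ?_⟩
    · convert x.2
      exact Fin.cons_self_tail x.1
    · intro x
      ext i
      exact congrFun (Fin.cons_self_tail x.1) i
    · rintro ⟨y, t, h⟩
      rfl
  have h2 : ∀ y : Fin n → F, Nat.card {t : F // eval (Fin.cons t y : Fin (n+1) → F) f = 0} ≤
      if eval y c = 0 then Fintype.card F else e := by
    intro y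
    split_ifs with h
    · refine (Nat.card_le_card_of_injective _ Subtype.val_injective).trans ?_
      simp
    · set p := Polynomial.map (eval y) P with hp
      have hp0 : p ≠ 0 := by
        intro h0
        apply h
        have := congrArg (fun r => Polynomial.coeff r e) h0
        simp only [hp, Polynomial.coeff_map, Polynomial.coeff_zero] at this
        exact this
      have : ∀ t, eval (Fin.cons t y : Fin (n+1) → F) f = 0 ↔ t ∈ p.roots.toFinset := by
        intro t
        rw [eval_eq_eval_mv_eval']
        rw [Multiset.mem_toFinset, Polynomial.mem_roots hp0]
        rfl
      simp only [this]
      rw [Nat.card_eq_fintype_card, Fintype.card_coe]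
      exact (Multiset.toFinset_card_le _).trans ((Polynomial.card_roots' _).trans Polynomial.natDegree_map_le)
  have h3 : zc c = (Finset.univ.filter (fun y : Fin n → F => eval y c = 0)).card := by
    unfold zc
    rw [Nat.card_eq_fintype_card, Fintype.card_subtype]
  have h4 : zc c + (Finset.univ.filter (fun y : Fin n → F => ¬ eval y c = 0)).card = Fintype.card F ^ n := by
    rw [h3, Finset.card_filter_add_card_filter_not]; simp
  have h5 : zc f ≤ zc c * Fintype.card F + (Finset.univ.filter (fun y : Fin n → F => ¬ eval y c = 0)).card * e := by
    rw [h1]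
    refine (Finset.sum_le_sum (fun y _ => h2 y)).trans ?_
    rw [Finset.sum_ite, h3]; simp
  rw [← h4]
  nlinarith

theorem homog_one {F : Type} [Field F] [Fintype F] {n : ℕ} {d : ℕ} (f : MvPolynomial (Fin (n+1)) F)
    (w : Fin (n+1) → ℕ) (hf : IsWeightedHomogeneous w f d) (e : ℕ) (hne : (finSuccEquiv F n f).coeff e ≠ 0) :
    ∃ d', d' + e * w 0 = d ∧ IsWeightedHomogeneous (fun i => w i.succ) ((finSuccEquiv F n f).coeff e) d' := by
  have key : ∀ s, coeff s ((finSuccEquiv F n f).coeff e) ≠ 0 → 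
     Finsupp.weight (fun i => w i.succ) s + e * w 0 = d := by
    intro s hs
    rw [finSuccEquiv_coeff_coeff] at hs
    have := hf hs
    rw [Finsupp.weight_apply, Finsupp.sum_fintype _ _ (by simp)] at this ⊢
    rw [Fin.sum_univ_succ] at this
    simp at this ⊢
    omega
  obtain ⟨s, hs⟩ := exists_coeff_ne_zero hne
  refine ⟨_, key s hs, ?_⟩
  intro t ht
  have := key s hs
  have := key t ht
  omega

theorem zc_const {F : Type} [Field F] [Fintype F] {n : ℕ} (f : MvPolynomial (Fin n) F) (w : Fin n → ℕ)
   (hw : ∀ i, 1 ≤ w i)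
   (hf : IsWeightedHomogeneous w f 0) (h0 : f ≠ 0) : zc f = 0 ∧ ∃ c, f = C c := by
  have : f = C (coeff 0 f) := by
    ext s
    rw [coeff_C]
    split_ifs with h
    · rw [h]
    · by_contra hh
      apply h
      have := hf hh
      rw [Finsupp.weight_apply, Finsupp.sum_fintype _ _ (by simp)] at this
      ext i
      have := (Finset.sum_eq_zero_iff.1 this) i (Finset.mem_univ _)
      have := hw i
      simp at *
      omega
  refine ⟨?_, _, this⟩
  unfold zc
  have h1 : coeff 0 f ≠ 0 := by rintro h; apply h0; rw [this, h]; simp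
  rw [this]
  simp [h1]

theorem zc_comp {F : Type} [Field F] [Fintype F] {n : ℕ} (f g : MvPolynomial (Fin n) F)
    (φ : (Fin n → F) → (Fin n → F)) (hφ : Function.Injective φ) 
    (h : ∀ x, eval x g = 0 ↔ eval (φ x) f = 0) : zc f = zc g := by
  unfold zc
  have hb : Function.Bijective φ := (Finite.injective_iff_bijective).1 hφ
  symm
  exact Nat.card_congr ((Equiv.ofBijective φ hb).subtypeEquiv (by intro a; simp [h]))

theorem exists_mat {F : Type} [Field F] {n : ℕ} (v : Fin (n+1) → F) (hv : v ≠ 0) :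
    ∃ A B : Matrix (Fin (n+1)) (Fin (n+1)) F, A * B = 1 ∧ B * A = 1 ∧ A.mulVec (Pi.single 0 1) = v := by
  have : ∃ g : (Fin (n+1) → F) ≃ₗ[F] (Fin (n+1) → F), g (Pi.single 0 1) = v := by
    have h0 : (Pi.single 0 1 : Fin (n+1) → F) ≠ 0 := by simp
    let f := (LinearEquiv.toSpanNonzeroSingleton F _ _ h0).symm.trans (LinearEquiv.toSpanNonzeroSingleton F _ _ hv)
    obtain ⟨g, hg⟩ := Submodule.exists_linearEquiv_restrict_eq f
    refine ⟨g, ?_⟩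
    have h1 := hg ⟨_, Submodule.mem_span_singleton_self _⟩
    have h2 : (LinearEquiv.toSpanNonzeroSingleton F _ _ h0).symm ⟨Pi.single 0 1, Submodule.mem_span_singleton_self _⟩ = 1 := by
      rw [LinearEquiv.symm_apply_eq, LinearEquiv.toSpanNonzeroSingleton_one]
    refine h1.symm.trans ?_
    simp only [f, LinearEquiv.trans_apply]
    rw [h2, LinearEquiv.toSpanNonzeroSingleton_one]
  obtain ⟨g, hg⟩ := this
  refine ⟨LinearMap.toMatrix' g.toLinearMap, LinearMap.toMatrix' g.symm.toLinearMap, ?_, ?_, ?_⟩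
  · rw [← LinearMap.toMatrix'_comp]; simp
  · rw [← LinearMap.toMatrix'_comp]; simp
  · rw [← Matrix.toLin'_apply]; simp [hg]

theorem eval_wscale {R : Type*} [CommSemiring R] {n d : ℕ} (w : Fin n → ℕ) (f : MvPolynomial (Fin n) R)
    (hf : IsWeightedHomogeneous w f d) (t : R) (x : Fin n → R) :
    eval (fun i => t ^ w i * x i) f = t ^ d * eval x f := by
  rw [eval_eq', eval_eq', Finset.mul_sum]
  refine Finset.sum_congr rfl fun s hs => ?_
  have := hf (mem_support_iff.1 hs)
  rw [Finsupp.weight_apply, Finsupp.sum_fintype _ _ (by simp)] at this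
  simp_rw [mul_pow, Finset.prod_mul_distrib, ← pow_mul, Finset.prod_pow_eq_pow_sum]
  simp only [smul_eq_mul] at this
  simp_rw [mul_comm (w _), this]
  ring

theorem eval_e0 {F : Type} [Field F] {n D : ℕ} (f : MvPolynomial (Fin (n+1)) F)
    (hf : f.IsHomogeneous D) : eval (Pi.single 0 1) f = coeff (Finsupp.single 0 D) f := by
  rw [eval_eq', Finset.sum_eq_single (Finsupp.single 0 D)]
  · rw [Finset.prod_eq_one, mul_one]
    intro i _
    by_cases h : i = 0
    · subst h; simp
    · simp [Finsupp.single_eq_of_ne h]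
  · intro s hs hne
    have := hf (mem_support_iff.1 hs)
    rw [Finsupp.weight_apply, Finsupp.sum_fintype _ _ (by simp), Fin.sum_univ_succ] at this
    have : ∃ i : Fin n, s i.succ ≠ 0 := by
      by_contra hh
      push Not at hh
      apply hne
      simp only [hh] at this
      ext i
      refine Fin.cases ?_ (fun j => ?_) i
      · simpa using this
      · simp [hh, Finsupp.single_eq_of_ne]
    obtain ⟨i, hi⟩ := this
    rw [Finset.prod_eq_zero (Finset.mem_univ i.succ), mul_zero]
    simp [Pi.single_eq_of_ne, hi]
  · intro h
    rw [notMem_support_iff.1 h, zero_mul]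

theorem zc_le_one {F : Type} [Field F] [Fintype F] {n : ℕ} (f : MvPolynomial (Fin n) F)
    (hz : ¬ ∃ v : Fin n → F, v ≠ 0 ∧ eval v f = 0) : zc f ≤ 1 := by
  unfold zc
  have : Subsingleton {x : Fin n → F // eval x f = 0} := by
    constructor
    rintro ⟨x, hx⟩ ⟨y, hy⟩
    have h1 : x = 0 := by by_contra h; exact hz ⟨x, h, hx⟩
    have h2 : y = 0 := by by_contra h; exact hz ⟨y, h, hy⟩
    simp [h1, h2]
  exact Finite.card_le_one_iff_subsingleton.2 this

theorem arith_base (q n D M : ℕ) (hq : 2 ≤ q) (hM : M ≤ 1) (hD : 1 ≤ D) :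
    q * M ≤ q ^ n * (D * (q - 1) + 1) := by
  obtain ⟨r, rfl⟩ : ∃ r, q = r + 1 := ⟨q - 1, by omega⟩
  simp only [Nat.add_sub_cancel]
  have : 1 ≤ (r+1)^n := Nat.one_le_pow _ _ (by omega)
  calc (r+1) * M ≤ (r+1) * 1 := Nat.mul_le_mul_left _ hM
    _ = 1 * (1 * r + 1) := by ring
    _ ≤ _ := by gcongr

theorem serre {F : Type} [Field F] [Fintype F] (n : ℕ) : ∀ (D : ℕ) (f : MvPolynomial (Fin (n+1)) F), f ≠ 0 →
    f.IsHomogeneous D → 1 ≤ D → D ≤ Fintype.card F →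
    Fintype.card F * zc f ≤ Fintype.card F ^ n * (D * (Fintype.card F - 1) + 1) := by
  have hq : 2 ≤ Fintype.card F := Fintype.one_lt_card
  induction n with
  | zero =>
    intro D f h0 hf hD hDq
    refine arith_base _ _ _ _ hq (zc_le_one f ?_) hD
    rintro ⟨v, hv, hfv⟩
    apply h0
    apply hf.eq_zero_of_forall_eval_eq_zero_of_le_card
    · intro x
      have hv0 : v 0 ≠ 0 := by
        intro h; apply hv; ext i; rw [show i = 0 from Fin.ext (by omega), h]; rfl
      have := eval_wscale _ f hf (x 0 / v 0) v
      rw [hfv, mul_zero] at this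
      have hx : x = fun i => (x 0 / v 0) ^ (1 : Fin (0+1) → ℕ) i * v i := by
        ext i
        rw [show i = 0 from Fin.ext (by omega)]
        simp [hv0]
      rw [hx]
      exact this
    · simpa using hDq
  | succ n ih =>
    intro D f h0 hf hD hDq
    by_cases hz : ∃ v : Fin (n+2) → F, v ≠ 0 ∧ eval v f = 0
    · obtain ⟨v, hv, hfv⟩ := hz
      obtain ⟨A, B, hAB, hBA, hAv⟩ := exists_mat v hv
      set g := bind₁ A.toMvPolynomial f with hg
      have hgf : bind₁ B.toMvPolynomial g = f := by
        rw [hg, bind₁_bind₁]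
        simp_rw [← Matrix.toMvPolynomial_mul, hAB, Matrix.toMvPolynomial_one]
        simp [bind₁_X_left]
      have hg0 : g ≠ 0 := by rintro h; apply h0; rw [← hgf, h]; simp
      have hgh : g.IsHomogeneous D := by
        have := hf.aeval A.toMvPolynomial (n := 1) (fun i => A.toMvPolynomial_isHomogeneous i)
        simpa using this
      have hev : ∀ x, eval x g = eval (A.mulVec x) f := by
        intro x
        have : A.mulVec x = fun i => eval x (A.toMvPolynomial i) := by
          ext i; rw [Matrix.toMvPolynomial_eval_eq_apply]
        rw [hg, this]
        exact eval₂Hom_bind₁ _ _ _ _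
      have hzz : zc f = zc g := by
        refine zc_comp f g (fun x => A.mulVec x) ?_ ?_
        · intro x y hxy
          have := congrArg B.mulVec hxy
          simpa [hBA] using this
        · intro x; rw [hev]
      rw [hzz]
      have hP0 : finSuccEquiv F (n+1) g ≠ 0 := by simpa using hg0
      have hc0 : (finSuccEquiv F (n+1) g).leadingCoeff ≠ 0 := Polynomial.leadingCoeff_ne_zero.2 hP0
      obtain ⟨d', hd', hh⟩ := homog_one g _ hgh _ hc0
      have hd1 : 1 ≤ d' := by
        by_contra hlt
        have : d' = 0 := by omega
        subst this
        obtain ⟨c, hc⟩ := (zc_const _ _ (by simp) hh hc0).2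
        have h1 := eval_e0 g hgh
        rw [hev, hAv, hfv] at h1
        have h2 : (Finsupp.single 0 D : Fin (n+2) →₀ ℕ) = Finsupp.cons D 0 := by
          ext i
          refine Fin.cases ?_ (fun j => ?_) i
          · simp
          · simp [Finsupp.single_eq_of_ne]
        rw [h2, ← finSuccEquiv_coeff_coeff] at h1
        simp at hd'
        rw [← hd', hc] at h1
        simp at h1
        apply hc0
        rw [Polynomial.leadingCoeff, hc, ← h1]; simp
      simp at hd'
      refine arith_peel _ n (finSuccEquiv F (n+1) g).natDegree D d' _ _ hq (by omega) hd1 (by omega) hDq (ih d' _ hc0 hh hd1 (by omega)) (peel g)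
    · exact arith_base _ _ _ _ hq (zc_le_one f hz) hD

theorem convert_homog {F : Type} [Field F] [Fintype F] {n : ℕ} (w : Fin (n+1) → ℕ) (a : ℕ) (ha : 1 ≤ a)
    (hl : w (Fin.last n) = 1) (hw : ∀ i : Fin n, w i.castSucc = a) (d : ℕ) (hd : 1 ≤ d)
    (f : MvPolynomial (Fin (n+1)) F) (h0 : f ≠ 0) (hf : IsWeightedHomogeneous w f d) :
    ∃ g : MvPolynomial (Fin (n+1)) F, g ≠ 0 ∧ g.IsHomogeneous ((d-1)/a+1) ∧ zc f = zc g := by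
  classical
  set D := (d-1)/a+1 with hD
  have hD1 : d ≤ a * D := by
    have := Nat.div_add_mod (d-1) a
    have := Nat.mod_lt (d-1) ha
    rw [hD, mul_add]; omega
  have hD2 : a * D < d + a := by
    have := Nat.div_add_mod (d-1) a
    rw [hD, mul_add]; omega
  have hDd : D ≤ d := by
    have := Nat.div_le_self (d-1) a
    omega
  clear_value D
  let S : (Fin (n+1) →₀ ℕ) → ℕ := fun s => ∑ i : Fin n, s i.castSucc
  have hS : ∀ s ∈ f.support, a * S s + s (Fin.last n) = d := by
    intro s hs
    have := hf (mem_support_iff.1 hs)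
    rw [Finsupp.weight_apply, Finsupp.sum_fintype _ _ (by simp), Fin.sum_univ_castSucc] at this
    simp only [hw, hl, smul_eq_mul, mul_one, ← Finset.sum_mul] at this
    rw [mul_comm]; exact this
  have hSD : ∀ s ∈ f.support, S s ≤ D := by
    intro s hs
    have := hS s hs
    by_contra h
    have : a * (D+1) ≤ a * S s := Nat.mul_le_mul_left _ (by omega)
    rw [mul_add] at this
    omega
  have hS0 : ∀ s ∈ f.support, (D - S s = 0 ↔ s (Fin.last n) = 0) := by
    intro s hs
    have h1 := hS s hs
    have h2 := hSD s hs
    constructor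
    · intro h
      have : S s = D := by omega
      rw [this] at h1
      omega
    · intro h
      have : a * D < a * (S s + 1) := by rw [mul_add]; omega
      have := Nat.lt_of_mul_lt_mul_left this
      omega
  let T : (Fin (n+1) →₀ ℕ) → (Fin (n+1) →₀ ℕ) := fun s => s.update (Fin.last n) (D - S s)
  have hT1 : ∀ s (i : Fin n), T s i.castSucc = s i.castSucc := by
    intro s i
    simp [T, Finsupp.update_apply, Fin.ext_iff, i.2.ne]
  have hT2 : ∀ s, T s (Fin.last n) = D - S s := by
    intro s
    simp [T]
  have hTinj : ∀ s ∈ f.support, ∀ s' ∈ f.support, T s = T s' → s = s' := by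
    intro s hs s' hs' h
    have h1 : ∀ i : Fin n, s i.castSucc = s' i.castSucc := fun i => by rw [← hT1, h, hT1]
    have h2 : S s = S s' := Finset.sum_congr rfl fun i _ => h1 i
    ext i
    refine Fin.lastCases ?_ (fun j => ?_) i
    · have := hS s hs
      have := hS s' hs'
      rw [h2] at *
      omega
    · exact h1 j
  refine ⟨∑ s ∈ f.support, monomial (T s) (coeff s f), ?_, ?_, ?_⟩
  · obtain ⟨s, hs⟩ := exists_coeff_ne_zero h0
    intro h
    have := congrArg (coeff (T s)) h
    rw [coeff_sum, Finset.sum_eq_single s] at this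
    · simp [hs] at this
    · intro s' hs' hne
      rw [coeff_monomial, if_neg]
      intro hh
      exact hne (hTinj _ hs' _ (mem_support_iff.2 hs) hh)
    · intro h; exact absurd (mem_support_iff.2 hs) h
  · apply IsHomogeneous.sum
    intro s hs
    apply isHomogeneous_monomial
    rw [Finsupp.degree_eq_sum, Fin.sum_univ_castSucc]
    simp only [hT1, hT2]
    have := hSD s hs
    change S s + _ = D
    omega
  · let φ : (Fin (n+1) → F) → (Fin (n+1) → F) := fun x =>
      if x (Fin.last n) = 0 then x else Fin.snoc (fun i => x (Fin.last n) ^ (a-1) * x i.castSucc) (x (Fin.last n))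
    have hφl : ∀ x, φ x (Fin.last n) = x (Fin.last n) := by
      intro x
      simp only [φ]
      split_ifs <;> simp
    have hφ0 : ∀ x, x (Fin.last n) = 0 → φ x = x := by
      intro x hx; simp only [φ, hx, if_true]
    have hφ1 : ∀ x, x (Fin.last n) ≠ 0 → ∀ i : Fin n, φ x i.castSucc = x (Fin.last n) ^ (a-1) * x i.castSucc := by
      intro x hx i; simp only [φ, hx, if_false]; simp
    apply zc_comp _ _ φ
    · intro x y hxy
      have hl : x (Fin.last n) = y (Fin.last n) := by rw [← hφl x, hxy, hφl]
      by_cases hx : x (Fin.last n) = 0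
      · rw [hφ0 x hx, hφ0 y (hl ▸ hx)] at hxy; exact hxy
      · ext i
        refine Fin.lastCases hl (fun j => ?_) i
        have := congrFun hxy j.castSucc
        rw [hφ1 x hx, hφ1 y (hl ▸ hx), ← hl] at this
        exact mul_left_cancel₀ (pow_ne_zero _ hx) this
    · intro x
      rw [map_sum]
      simp only [eval_monomial]
      rw [eval_eq']
      by_cases hx : x (Fin.last n) = 0
      · rw [hφ0 x hx]
        apply Eq.congr_left
        refine Finset.sum_congr rfl fun s hs => ?_
        rw [Finsupp.prod_fintype _ _ (by simp), Fin.prod_univ_castSucc, Fin.prod_univ_castSucc]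
        simp only [hT1, hT2, hx]
        congr 2
        by_cases h : s (Fin.last n) = 0
        · rw [h, (hS0 s hs).2 h]
        · rw [zero_pow h, zero_pow]
          intro h'; exact h ((hS0 s hs).1 h')
      · have key : ∑ s ∈ f.support, coeff s f * ∏ i, φ x i ^ s i = x (Fin.last n) ^ (d - D) *
            ∑ s ∈ f.support, coeff s f * ((T s).prod fun i k => x i ^ k) := by
          rw [Finset.mul_sum]
          refine Finset.sum_congr rfl fun s hs => ?_
          rw [Finsupp.prod_fintype _ _ (by simp), Fin.prod_univ_castSucc, Fin.prod_univ_castSucc]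
          simp only [hT1, hT2, hφ1 x hx, hφl, mul_pow, Finset.prod_mul_distrib, ← pow_mul, Finset.prod_pow_eq_pow_sum, ← Finset.mul_sum]
          change _ * (x (Fin.last n) ^ ((a-1) * S s) * _ * _) = _
          have h1 := hS s hs
          have h2 := hSD s hs
          have : (a-1) * S s + s (Fin.last n) = (d - D) + (D - S s) := by
            obtain ⟨b, rfl⟩ : ∃ b, a = b + 1 := ⟨a-1, by omega⟩
            simp only [Nat.add_sub_cancel]
            rw [add_mul] at h1
            omega
          have h3 : x (Fin.last n) ^ ((a-1) * S s) * x (Fin.last n) ^ s (Fin.last n) = x (Fin.last n) ^ (d-D) * x (Fin.last n) ^ (D - S s) := by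
            rw [← pow_add, this, pow_add]
          calc _ = coeff s f * (∏ i : Fin n, x i.castSucc ^ s i.castSucc) * (x (Fin.last n) ^ ((a-1) * S s) * x (Fin.last n) ^ s (Fin.last n)) := by ring
            _ = _ := by rw [h3]; ring
        rw [key]
        simp [hx]

theorem wserre {F : Type} [Field F] [Fintype F] (a : ℕ) (ha : 1 ≤ a) (n : ℕ) : ∀ (w : Fin (n+1) → ℕ) (d : ℕ)
    (f : MvPolynomial (Fin (n+1)) F), w (Fin.last n) = 1 → (∀ i : Fin n, a ≤ w i.castSucc) →
    (∀ i j : Fin n, i ≤ j → w j.castSucc ≤ w i.castSucc) → f ≠ 0 →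
    IsWeightedHomogeneous w f d → 1 ≤ d → (d-1)/a+1 ≤ Fintype.card F →
    Fintype.card F * zc f ≤ Fintype.card F ^ n * (((d-1)/a+1) * (Fintype.card F - 1) + 1) := by
  have hq : 2 ≤ Fintype.card F := Fintype.one_lt_card
  induction n with
  | zero =>
    intro w d f hl hw hmono h0 hf hd hD
    obtain ⟨g, hg0, hg, hz⟩ := convert_homog w a ha hl (fun i => i.elim0) d hd f h0 hf
    rw [hz]
    exact serre _ _ g hg0 hg (Nat.le_add_left _ _) hD
  | succ n ih =>
    intro w d f hl hw hmono h0 hf hd hD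
    by_cases hwa : w 0 = a
    · obtain ⟨g, hg0, hg, hz⟩ := convert_homog w a ha hl (fun i => le_antisymm (hwa ▸ hmono 0 i (Fin.zero_le _)) (hw i)) d hd f h0 hf
      rw [hz]
      exact serre _ _ g hg0 hg (Nat.le_add_left _ _) hD
    · have hlt : a + 1 ≤ w 0 := by
        have : a ≤ w 0 := hw 0
        omega
      have hP0 : finSuccEquiv F (n+1) f ≠ 0 := by simpa using h0
      have hc0 : (finSuccEquiv F (n+1) f).leadingCoeff ≠ 0 := Polynomial.leadingCoeff_ne_zero.2 hP0
      obtain ⟨d', hd', hh⟩ := homog_one f _ hf _ hc0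
      have hpeel := peel f
      set e := (finSuccEquiv F (n+1) f).natDegree with he
      set D := (d-1)/a+1 with hDdef
      have hew : e * a + e ≤ e * w 0 := by
        calc e * a + e = e * (a+1) := by ring
          _ ≤ _ := Nat.mul_le_mul_left _ hlt
      by_cases hd1 : 1 ≤ d'
      · have hDe : (d'-1)/a+1 + e ≤ D := by
          have : (d'-1)/a + e = (d' - 1 + e * a)/a := by rw [Nat.add_mul_div_right _ _ ha]
          have : (d' - 1 + e * a)/a ≤ (d-1)/a := Nat.div_le_div_right (by omega)
          omega
        have hDe' : (d'-1)/a+1 ≤ D := (Nat.le_add_right _ _).trans hDe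
        refine arith_peel _ n e D ((d'-1)/a+1) _ _ hq (((Nat.le_add_left _ _).trans hDe).trans hD) (Nat.le_add_left _ _) hDe hD ?_ hpeel
        refine ih _ d' _ hl (fun i => hw i.succ) (fun i j hij => hmono i.succ j.succ (Fin.succ_le_succ_iff.2 hij)) hc0 hh hd1 (hDe'.trans hD)
      · have : d' = 0 := by omega
        subst this
        have hz := (zc_const _ _ (by
          intro i
          refine Fin.lastCases ?_ (fun j => ?_) i
          · exact hl.ge
          · exact ha.trans (hw j.succ)) hh hc0).1
        have hz' : zc (finSuccEquiv F (n+1) f).leadingCoeff = 0 := hz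
        rw [hz'] at hpeel
        have heD : e + 1 ≤ D := by
          have : e * a / a ≤ (d-1)/a := by
            refine Nat.div_le_div_right ?_
            rcases Nat.eq_zero_or_pos e with h | h
            · simp [h]
            · omega
          rw [Nat.mul_div_cancel _ ha] at this
          omega
        refine arith_peel _ n e D 1 0 _ hq (by omega) le_rfl (by omega) hD (by simp) ?_
        simpa using hpeel

theorem fixed_mem {F : Type} [Field F] [Fintype F] (x : AlgebraicClosure F) (hx : x ^ Fintype.card F = x) :
    ∃ a : F, algebraMap F (AlgebraicClosure F) a = x := by
  classical
  have hq : 1 < Fintype.card F := Fintype.one_lt_card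
  set p : Polynomial (AlgebraicClosure F) := Polynomial.X ^ Fintype.card F - Polynomial.X with hp
  have hp0 : p ≠ 0 := FiniteField.X_pow_card_sub_X_ne_zero _ hq
  have hdeg : p.natDegree = Fintype.card F := FiniteField.X_pow_card_sub_X_natDegree_eq _ hq
  have hsub : Finset.univ.image (algebraMap F (AlgebraicClosure F)) ⊆ p.roots.toFinset := by
    intro y hy
    obtain ⟨a, -, rfl⟩ := Finset.mem_image.1 hy
    rw [Multiset.mem_toFinset, Polynomial.mem_roots hp0]
    simp [hp, Polynomial.IsRoot, ← map_pow, FiniteField.pow_card]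
  have heq := Finset.eq_of_subset_of_card_le hsub (by
    rw [Finset.card_image_of_injective _ (algebraMap F (AlgebraicClosure F)).injective, Finset.card_univ, ← hdeg]
    exact (Multiset.toFinset_card_le _).trans (Polynomial.card_roots' _))
  have : x ∈ p.roots.toFinset := by
    rw [Multiset.mem_toFinset, Polynomial.mem_roots hp0]
    simp [hp, Polynomial.IsRoot, hx]
  rw [← heq] at this
  obtain ⟨a, -, h⟩ := Finset.mem_image.1 this
  exact ⟨a, h⟩

theorem wRel_equiv (F : Type) [Field F] {m : ℕ} (w : Fin (m + 1) → ℕ) : Equivalence (wRel F w) := by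
  refine ⟨fun x => ⟨1, by simp⟩, ?_, ?_⟩
  · rintro x y ⟨l, h⟩
    refine ⟨l⁻¹, fun i => ?_⟩
    rw [h i, ← mul_assoc, ← mul_pow]
    simp
  · rintro x y z ⟨l, h⟩ ⟨k, h'⟩
    refine ⟨k * l, fun i => ?_⟩
    rw [h' i, h i]
    push_cast
    ring

theorem mk_eq_iff (F : Type) [Field F] {m : ℕ} (w : Fin (m + 1) → ℕ)
    (x y : {v : Fin (m + 1) → AlgebraicClosure F // v ≠ 0}) : PW.mk F w x = PW.mk F w y ↔ wRel F w x y := by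
  constructor
  · intro h
    exact (wRel_equiv F w).eqvGen_iff.1 (Quot.eqvGen_exact h)
  · intro h; exact Quot.sound h

/-- rational vectors as vectors over the closure -/
def emb {F : Type} [Field F] {m : ℕ} (x : {v : Fin (m + 1) → F // v ≠ 0}) :
    {v : Fin (m + 1) → AlgebraicClosure F // v ≠ 0} :=
  ⟨fun i => algebraMap F (AlgebraicClosure F) (x.1 i), by
    intro h
    apply x.2
    ext i
    have := congrFun h i
    simpa using this⟩

theorem emb_mem {F : Type} [Field F] [Fintype F] {m : ℕ} (w : Fin (m + 1) → ℕ) (x : {v : Fin (m + 1) → F // v ≠ 0}) :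
    PW.mk F w (emb x) ∈ ratPts F w := by
  have : (fun i => (emb x).1 i ^ Fintype.card F) = (emb x).1 := by
    ext i
    simp [emb, ← map_pow, FiniteField.pow_card]
  refine ⟨emb x, rfl, ?_⟩
  refine ⟨by rw [this]; exact (emb x).2, ?_⟩
  congr 1
  exact Subtype.ext this

theorem ratPts_emb {F : Type} [Field F] [Fintype F] {m : ℕ} (w : Fin (m + 1) → ℕ) (c : PW F w) (hc : c ∈ ratPts F w) :
    ∃ x, PW.mk F w (emb x) = c := by
  have hq : 1 < Fintype.card F := Fintype.one_lt_card
  obtain ⟨y, rfl, h, hy⟩ := hc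
  obtain ⟨l, hl⟩ := (mk_eq_iff F w _ _).1 hy
  obtain ⟨z, hz⟩ := IsAlgClosed.exists_pow_nat_eq (l : AlgebraicClosure F) (n := Fintype.card F - 1) (by omega)
  have hz0 : z ≠ 0 := by
    rintro rfl
    rw [zero_pow (by omega)] at hz
    exact l.ne_zero hz.symm
  have hzq : z ^ Fintype.card F = z * l := by
    rw [← hz, ← pow_succ']; congr 1; omega
  have hfix : ∀ i, (z ^ w i * y.1 i) ^ Fintype.card F = z ^ w i * y.1 i := by
    intro i
    have := hl i
    simp only at this
    have h2 : y.1 i ^ Fintype.card F * (l:AlgebraicClosure F) ^ w i = y.1 i := by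
      rw [mul_comm]; exact this.symm
    rw [mul_pow, ← pow_mul, mul_comm (w i), pow_mul, hzq, mul_pow]
    linear_combination z ^ w i * h2
  choose a ha using fun i => fixed_mem _ (hfix i)
  have ha0 : a ≠ 0 := by
    intro h0
    apply y.2
    ext i
    have := ha i
    rw [h0] at this
    simp [hz0] at this
    simpa using this
  refine ⟨⟨a, ha0⟩, ?_⟩
  symm
  rw [mk_eq_iff]
  exact ⟨Units.mk0 z hz0, fun i => by simp [emb, ha]⟩

theorem fiber_card {F : Type} [Field F] [Fintype F] {m : ℕ} (w : Fin (m + 1) → ℕ) (hw : ∀ i, 1 ≤ w i)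
    (x : {v : Fin (m + 1) → F // v ≠ 0}) :
    Nat.card {y : {v : Fin (m + 1) → F // v ≠ 0} // PW.mk F w (emb y) = PW.mk F w (emb x)} = Fintype.card F - 1 := by
  classical
  have hq : 1 < Fintype.card F := Fintype.one_lt_card
  set s : Finset (Fin (m+1)) := Finset.univ.filter (fun i => x.1 i ≠ 0) with hs
  obtain ⟨i0, hi0⟩ : ∃ i, x.1 i ≠ 0 := by
    by_contra h
    push Not at h
    exact x.2 (funext h)
  have hi0s : i0 ∈ s := by simp [hs, hi0]
  set g := s.gcd w with hg
  have hgd : ∀ i ∈ s, g ∣ w i := fun i hi => Finset.gcd_dvd hi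
  have hg0 : 0 < g := Nat.pos_of_dvd_of_pos (hgd _ hi0s) (hw _)
  have hg1 : s.gcd (fun i => w i / g) = 1 := Finset.gcd_div_eq_one hi0s (by have := hw i0; omega)
  let φ : Fˣ → {y : {v : Fin (m + 1) → F // v ≠ 0} // PW.mk F w (emb y) = PW.mk F w (emb x)} := fun t =>
    ⟨⟨fun i => (t:F) ^ (w i / g) * x.1 i, by
      intro h
      have := congrFun h i0
      simp [hi0] at this⟩, by
      obtain ⟨z, hz⟩ := IsAlgClosed.exists_pow_nat_eq (algebraMap F (AlgebraicClosure F) t) hg0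
      have hz0 : z ≠ 0 := by
        rintro rfl
        rw [zero_pow hg0.ne'] at hz
        have := hz.symm
        simp at this
      symm
      rw [mk_eq_iff]
      refine ⟨Units.mk0 z hz0, fun i => ?_⟩
      by_cases hi : x.1 i = 0
      · simp [emb, hi]
      · have hi' : i ∈ s := by simp [hs, hi]
        simp only [emb, map_mul, map_pow, Units.val_mk0]
        rw [← hz, ← pow_mul, Nat.mul_div_cancel' (hgd i hi')]⟩
  have hφ : Function.Bijective φ := by
    constructor
    · intro t u htu
      have h1 : ∀ i ∈ s, (t * u⁻¹) ^ (w i / g) = 1 := by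
        intro i hi
        have h2 := congrFun (congrArg (fun r => r.1.1) htu) i
        simp only [φ] at h2
        have hi' : x.1 i ≠ 0 := by simpa [hs] using hi
        have h3 := mul_right_cancel₀ hi' h2
        have h4 : t ^ (w i / g) = u ^ (w i / g) := by ext; push_cast; exact h3
        rw [mul_pow, h4, ← mul_pow]; simp
      have h2 : orderOf (t * u⁻¹) ∣ 1 := by
        rw [← hg1]
        exact Finset.dvd_gcd fun i hi => orderOf_dvd_of_pow_eq_one (h1 i hi)
      have h3 := orderOf_dvd_iff_pow_eq_one.1 h2
      rw [pow_one] at h3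
      exact mul_inv_eq_one.1 h3
    · rintro ⟨y, hy⟩
      obtain ⟨l, hl⟩ := (mk_eq_iff F w _ _).1 hy.symm
      have h1 : ∀ i ∈ s, l ^ (w i * (Fintype.card F - 1)) = 1 := by
        intro i hi
        have hi' : x.1 i ≠ 0 := by simpa [hs] using hi
        have h2 := hl i
        simp only [emb] at h2
        have h3 : (l : AlgebraicClosure F) ^ w i = algebraMap F _ (y.1 i / x.1 i) := by
          rw [map_div₀, h2]
          field_simp [hi']
        have h4 : y.1 i / x.1 i ≠ 0 := by
          intro h; rw [h] at h3
          simp at h3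
        ext
        push_cast
        rw [pow_mul, h3, ← map_pow, FiniteField.pow_card_sub_one_eq_one _ h4]
        simp
      have h2 : orderOf l ∣ g * (Fintype.card F - 1) := by
        have : (s.gcd fun i => w i * (Fintype.card F - 1)) = g * (Fintype.card F - 1) := by
          rw [Finset.gcd_mul_right]; simp [hg]
        rw [← this]
        exact Finset.dvd_gcd fun i hi => orderOf_dvd_of_pow_eq_one (h1 i hi)
      have h3 := orderOf_dvd_iff_pow_eq_one.1 h2
      have h4 : ((l : AlgebraicClosure F) ^ g) ^ Fintype.card F = l ^ g := by
        have : ((l : AlgebraicClosure F) ^ g) ^ (Fintype.card F - 1) = 1 := by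
          rw [← pow_mul]
          rw [← Units.val_pow_eq_pow_val, h3, Units.val_one]
        calc ((l : AlgebraicClosure F) ^ g) ^ Fintype.card F = ((l : AlgebraicClosure F) ^ g) ^ (Fintype.card F - 1 + 1) := by congr 1; omega
          _ = _ := by rw [pow_succ, this, one_mul]
      obtain ⟨t, ht⟩ := fixed_mem _ h4
      have ht0 : t ≠ 0 := by
        rintro rfl
        have := ht.symm
        simp at this
      refine ⟨Units.mk0 t ht0, ?_⟩
      apply Subtype.ext
      apply Subtype.ext
      ext i
      apply (algebraMap F (AlgebraicClosure F)).injective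
      have h5 := hl i
      simp only [emb] at h5
      rw [h5]
      simp only [φ, Units.val_mk0, map_mul, map_pow, ht]
      by_cases hi : x.1 i = 0
      · simp [hi]
      · have hi' : i ∈ s := by simp [hs, hi]
        rw [← pow_mul, Nat.mul_div_cancel' (hgd i hi')]
  rw [← Nat.card_congr (Equiv.ofBijective φ hφ), Nat.card_units, Nat.card_eq_fintype_card]

theorem eval_emb {F : Type} [Field F] {m : ℕ} (f : MvPolynomial (Fin (m+1)) F) (x : {v : Fin (m + 1) → F // v ≠ 0}) :
    eval (emb x).1 (map (algebraMap F (AlgebraicClosure F)) f) = 0 ↔ eval x.1 f = 0 := by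
  have : eval (emb x).1 (map (algebraMap F (AlgebraicClosure F)) f) = algebraMap F (AlgebraicClosure F) (eval x.1 f) := by
    rw [eval_map, ← aeval_def, ← coe_aeval_eq_eval]
    exact aeval_algebraMap_apply (AlgebraicClosure F) x.1 f
  rw [this]; simp

theorem map_wh {R S : Type*} [CommSemiring R] [CommSemiring S] (φ : R →+* S) {n d : ℕ} (w : Fin n → ℕ) (f : MvPolynomial (Fin n) R)
    (hf : IsWeightedHomogeneous w f d) : IsWeightedHomogeneous w (map φ f) d := by
  intro s hs
  apply hf
  intro h
  rw [coeff_map, h, map_zero] at hs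
  exact hs rfl

theorem vanish_card {F : Type} [Field F] [Fintype F] {m : ℕ} (w : Fin (m + 1) → ℕ) (hw : ∀ i, 1 ≤ w i)
    (f : MvPolynomial (Fin (m+1)) F) (d : ℕ) (hd : 1 ≤ d) (hf : IsWeightedHomogeneous w f d) :
    (Fintype.card F - 1) * (vanishSet F w f).ncard + 1 = zc f := by
  classical
  let s : Finset {v : Fin (m + 1) → F // v ≠ 0} := Finset.univ.filter (fun x => eval x.1 f = 0)
  have hinv : ∀ x y : {v : Fin (m + 1) → AlgebraicClosure F // v ≠ 0}, PW.mk F w x = PW.mk F w y →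
      eval x.1 (map (algebraMap F (AlgebraicClosure F)) f) = 0 →
      eval y.1 (map (algebraMap F (AlgebraicClosure F)) f) = 0 := by
    intro x y hxy hx
    obtain ⟨l, hl⟩ := (mk_eq_iff F w _ _).1 hxy
    have := eval_wscale w _ (map_wh (algebraMap F (AlgebraicClosure F)) w f hf) l x.1
    rw [hx, mul_zero] at this
    rw [← this]
    congr 2
    ext i
    exact hl i
  have hV : vanishSet F w f = ↑(s.image (fun x => PW.mk F w (emb x))) := by
    ext c
    simp only [Finset.coe_image, Set.mem_image, s, Finset.coe_filter, Finset.mem_univ, true_and, Set.mem_ofPred_eq]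
    constructor
    · rintro ⟨h1, h2⟩
      obtain ⟨x, rfl⟩ := ratPts_emb w c h1
      exact ⟨x, (eval_emb f x).1 (h2 _ rfl), rfl⟩
    · rintro ⟨x, hx, rfl⟩
      exact ⟨emb_mem w x, fun y hy => hinv _ _ hy.symm ((eval_emb f x).2 hx)⟩
  have hcard : s.card = (vanishSet F w f).ncard * (Fintype.card F - 1) := by
    rw [hV, Set.ncard_coe_finset, Finset.card_eq_sum_card_image (fun x => PW.mk F w (emb x)) s,
      Finset.sum_const_nat]
    intro c hc
    obtain ⟨x, hx, rfl⟩ := Finset.mem_image.1 hc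
    rw [← fiber_card w hw x, Nat.card_eq_fintype_card, Fintype.card_subtype]
    congr 1
    ext y
    simp only [s, Finset.mem_filter, Finset.mem_univ, true_and, and_iff_right_iff_imp]
    intro hy
    have hx' : eval x.1 f = 0 := by simpa [s] using hx
    exact (eval_emb f y).1 (hinv _ _ hy.symm ((eval_emb f x).2 hx'))
  have h0 : eval (0 : Fin (m+1) → F) f = 0 := by
    have := eval_wscale w f hf 0 0
    rw [zero_pow (by omega), zero_mul] at this
    rw [← this]
    congr 2
    ext i
    simp
  have hz : zc f = s.card + 1 := by
    unfold zc
    rw [Nat.card_eq_fintype_card, Fintype.card_subtype]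
    have : (Finset.univ.filter (fun x : Fin (m+1) → F => eval x f = 0)) = insert 0 (s.map (Function.Embedding.subtype _)) := by
      ext x
      simp only [Finset.mem_filter, Finset.mem_univ, true_and, Finset.mem_insert, Finset.mem_map, s]
      constructor
      · intro h
        by_cases hx : x = 0
        · exact Or.inl hx
        · exact Or.inr ⟨⟨x, hx⟩, h, rfl⟩
      · rintro (rfl | ⟨y, hy, rfl⟩)
        · exact h0
        · exact hy
    rw [this, Finset.card_insert_of_notMem, Finset.card_map]
    simp
  rw [hz, hcard, mul_comm]

theorem zc_rename {F : Type} [Field F] [Fintype F] {n d : ℕ} (w : Fin (n+1) → ℕ) (f : MvPolynomial (Fin (n+1)) F)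
    (hf : IsWeightedHomogeneous w f d) (h0 : f ≠ 0) : ∃ g : MvPolynomial (Fin (n+1)) F, g ≠ 0 ∧
      IsWeightedHomogeneous (fun i => w i.rev) g d ∧ zc f = zc g := by
  refine ⟨rename Fin.rev f, ?_, ?_, ?_⟩
  · intro h
    apply h0
    apply rename_injective _ Fin.rev_injective
    rw [h, map_zero]
  · intro s hs
    obtain ⟨u, rfl, hu⟩ := coeff_rename_ne_zero _ _ _ hs
    rw [← hf hu, Finsupp.weight_apply, Finsupp.weight_apply, Finsupp.sum_mapDomain_index (by simp) (by intros; simp [add_mul])]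
    simp
  · refine zc_comp _ _ (fun x => x ∘ Fin.rev) ?_ ?_
    · intro x y h
      ext i
      have := congrFun h i.rev
      simpa using this
    · intro x
      rw [eval_rename]

theorem pSum_eq (q k : ℕ) (hq : 1 ≤ q) : (q - 1) * pSum q k + 1 = q ^ k := by
  obtain ⟨r, rfl⟩ : ∃ r, q = r + 1 := ⟨q - 1, by omega⟩
  simp only [Nat.add_sub_cancel]
  unfold pSum
  induction k with
  | zero => simp
  | succ k ih => rw [Finset.sum_range_succ, pow_succ, ← ih]; nlinarith

theorem lower {F : Type} [Field F] [Fintype F] {n : ℕ} (w : Fin (n+2) → ℕ) (h0 : w 0 = 1) (d κ : ℕ)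
    (hκ : κ ≤ Fintype.card F) (hd : κ * w 1 + 1 ≤ d) :
    ∃ f : MvPolynomial (Fin (n+2)) F, f ≠ 0 ∧ IsWeightedHomogeneous w f d ∧
      Fintype.card F ^ n * (Fintype.card F + (Fintype.card F - 1) * κ) ≤ zc f := by
  classical
  obtain ⟨A, -, hA⟩ := Finset.exists_subset_card_eq (s := (Finset.univ : Finset F)) (n := κ) (by simpa using hκ)
  refine ⟨X 0 ^ (d - κ * w 1) * ∏ a ∈ A, (X 1 - C a * X 0 ^ w 1), ?_, ?_, ?_⟩
  · refine mul_ne_zero (pow_ne_zero _ (X_ne_zero _)) (Finset.prod_ne_zero_iff.2 fun a _ h => ?_)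
    have := congrArg (eval (fun i => if i = 1 then a * 0 ^ w 1 + 1 else 0)) h
    simp at this
  · have h1 : IsWeightedHomogeneous w (X 0 ^ (d - κ * w 1) : MvPolynomial (Fin (n+2)) F) (d - κ * w 1) := by
      have := (isWeightedHomogeneous_X F w 0).pow (d - κ * w 1)
      rw [h0] at this
      simpa using this
    have h2 : ∀ a ∈ A, IsWeightedHomogeneous w (X 1 - C a * X 0 ^ w 1 : MvPolynomial (Fin (n+2)) F) (w 1) := by
      intro a _
      refine (isWeightedHomogeneous_X F w 1).sub ?_
      apply IsWeightedHomogeneous.C_mul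
      have := (isWeightedHomogeneous_X F w 0).pow (w 1)
      rw [h0] at this
      simpa using this
    have := h1.mul (IsWeightedHomogeneous.prod A _ _ h2)
    rw [Finset.sum_const, hA, smul_eq_mul, Nat.sub_add_cancel (by omega)] at this
    exact this
  · set f : MvPolynomial (Fin (n+2)) F := X 0 ^ (d - κ * w 1) * ∏ a ∈ A, (X 1 - C a * X 0 ^ w 1) with hf
    let φ : (Fin n → F) × (F ⊕ (Fˣ × A)) → {x : Fin (n+2) → F // eval x f = 0} := fun p =>
      match p with
      | (y, Sum.inl s) => ⟨Fin.cons 0 (Fin.cons s y), by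
          have : d - κ * w 1 ≠ 0 := by omega
          simp [hf, this]⟩
      | (y, Sum.inr (t, a)) => ⟨Fin.cons (t:F) (Fin.cons (a.1 * (t:F) ^ w 1) y), by
          rw [hf, map_mul, map_prod, Finset.prod_eq_zero a.2, mul_zero]
          have h1 : (Fin.cons (t:F) (Fin.cons (a.1 * (t:F) ^ w 1) y : Fin (n+1) → F) : Fin (n+2) → F) 1 = a.1 * (t:F) ^ w 1 := rfl
          simp [h1]⟩
    have hφ : Function.Injective φ := by
      rintro ⟨y, s | ⟨t, a⟩⟩ ⟨y', s' | ⟨t', a'⟩⟩ h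
      · have h := congrArg Subtype.val h
        simp only [φ] at h
        obtain ⟨h1, h2⟩ := Fin.cons_injective2 h
        obtain ⟨h3, h4⟩ := Fin.cons_injective2 h2
        rw [h3, h4]
      · have h := congrArg Subtype.val h
        simp only [φ] at h
        obtain ⟨h1, h2⟩ := Fin.cons_injective2 h
        exact absurd h1.symm t'.ne_zero
      · have h := congrArg Subtype.val h
        simp only [φ] at h
        obtain ⟨h1, h2⟩ := Fin.cons_injective2 h
        exact absurd h1 t.ne_zero
      · have h := congrArg Subtype.val h
        simp only [φ] at h
        obtain ⟨h1, h2⟩ := Fin.cons_injective2 h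
        obtain ⟨h3, h4⟩ := Fin.cons_injective2 h2
        have h1 := Units.ext h1
        subst h1
        have h3 := mul_right_cancel₀ (pow_ne_zero _ t.ne_zero) h3
        rw [h4, Subtype.ext h3]
    have := Nat.card_le_card_of_injective φ hφ
    refine le_trans (le_of_eq ?_) this
    rw [Nat.card_prod, Nat.card_sum, Nat.card_prod, Nat.card_units]
    simp [hA]

/-- the refined Serre-type bound for weighted projective spaces
with first weight equal to one (Theorem 1.3 of the paper). -/
theorem stmt0 (F : Type) [Field F] [Fintype F] (m ℓ : ℕ) (w : Fin (m + 1) → ℕ)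
    (hℓ1 : 1 ≤ ℓ) (hℓm : ℓ + 1 ≤ m)
    (hpos : ∀ i, 1 ≤ w i)
    (hw0 : w ⟨0, by omega⟩ = 1)
    (hweq : ∀ i : Fin (m + 1), 1 ≤ (i : ℕ) → (i : ℕ) ≤ ℓ → w i = w ⟨1, by omega⟩)
    (hlt : w ⟨ℓ, by omega⟩ < w ⟨ℓ + 1, by omega⟩)
    (hmono : ∀ i j : Fin (m + 1), ℓ + 1 ≤ (i : ℕ) → i ≤ j → w i ≤ w j)
    (d : ℕ) (hd : 1 ≤ d) :
    eMax F w d =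
      min (pSum (Fintype.card F) (m + 1))
        (((d - 1) / w ⟨1, by omega⟩ + 1) * Fintype.card F ^ (m - 1)
          + pSum (Fintype.card F) (m - 1)) := by
  have hq : 2 ≤ Fintype.card F := Fintype.one_lt_card
  obtain ⟨n, rfl⟩ : ∃ n, m = n + 1 := ⟨m - 1, by omega⟩
  have e1 : (⟨1, by omega⟩ : Fin (n+1+1)) = 1 := rfl
  have e0 : (⟨0, by omega⟩ : Fin (n+1+1)) = 0 := rfl
  rw [e0] at hw0
  rw [e1] at hweq ⊢
  simp only [Nat.add_sub_cancel]
  set q := Fintype.card F with hqdef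
  set k := (d - 1) / w 1 with hk
  have hw1 : 1 ≤ w 1 := hpos 1
  set κ := min k q with hκ
  have hR : min (pSum q (n+1+1)) ((k+1) * q^n + pSum q n) = (κ+1) * q^n + pSum q n := by
    have : pSum q (n+1+1) = (q+1) * q^n + pSum q n := by
      unfold pSum
      rw [Finset.sum_range_succ, Finset.sum_range_succ]; ring
    rw [this]
    rcases le_total k q with h | h
    · rw [hκ, min_eq_left h, min_eq_right]
      gcongr
    · rw [hκ, min_eq_right h, min_eq_left]
      gcongr
  rw [hR]
  have hR2 : (q-1) * ((κ+1) * q^n + pSum q n) + 1 = q^n * (q + (q-1) * κ) := by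
    have := pSum_eq q n (by omega)
    obtain ⟨r, hr⟩ : ∃ r, q = r + 1 := ⟨q - 1, by omega⟩
    rw [mul_add, add_assoc, this, hr]
    simp only [Nat.add_sub_cancel]
    ring
  have hle : ∀ a b : ℕ, (q-1) * a + 1 ≤ (q-1) * b + 1 → a ≤ b := by
    intro a b h
    exact Nat.le_of_mul_le_mul_left (Nat.le_of_add_le_add_right h) (by omega)
  have hub : ∀ f : MvPolynomial (Fin (n+1+1)) F, f ≠ 0 → IsWeightedHomogeneous w f d →
      (vanishSet F w f).ncard ≤ (κ+1) * q^n + pSum q n := by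
    intro f h0 hf
    apply hle
    rw [hR2, vanish_card w hpos f d hd hf]
    rcases lt_or_ge k q with h | h
    · rw [hκ, min_eq_left h.le]
      obtain ⟨g, hg0, hg, hz⟩ := zc_rename w f hf h0
      rw [hz]
      have hwl : w 1 = w ⟨ℓ, by omega⟩ := (hweq ⟨ℓ, by omega⟩ hℓ1 le_rfl).symm
      have hmon : ∀ i j : Fin (n+1+1), 1 ≤ (i:ℕ) → i ≤ j → w i ≤ w j := by
        intro i j hi hij
        have hij' : (i:ℕ) ≤ j := hij
        by_cases h1 : ℓ + 1 ≤ (i:ℕ)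
        · exact hmono i j h1 hij
        · rw [hweq i hi (by omega)]
          by_cases h2 : ℓ + 1 ≤ (j:ℕ)
          · rw [hwl]
            exact hlt.le.trans (hmono _ _ le_rfl h2)
          · rw [hweq j (by omega) (by omega)]
      have hrev : ∀ i : Fin (n+1), 1 ≤ ((i.castSucc).rev : ℕ) := by
        intro i
        rw [Fin.val_rev, Fin.val_castSucc]
        omega
      have := wserre (w 1) hw1 (n+1) (fun i => w i.rev) d g (by simpa using hw0)
        (fun i => hmon 1 _ (by simp) (by rw [Fin.le_def]; simpa using hrev i))
        (fun i j hij => hmon _ _ (hrev j) (by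
          rw [Fin.rev_le_rev]; exact hij)) hg0 hg hd h
      have h3 : q * zc g ≤ q * (q^n * (q + (q-1)*k)) := by
        refine this.trans (le_of_eq ?_)
        change q^(n+1) * ((k+1) * (q-1) + 1) = _
        obtain ⟨r, hr⟩ : ∃ r, q = r + 1 := ⟨q - 1, by omega⟩
        rw [hr]
        simp only [Nat.add_sub_cancel]
        ring
      exact Nat.le_of_mul_le_mul_left h3 (by omega)
    · rw [hκ, min_eq_right h]
      refine (zc_le f).trans (le_of_eq ?_)
      change q^(n+1+1) = _
      obtain ⟨r, hr⟩ : ∃ r, q = r + 1 := ⟨q - 1, by omega⟩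
      rw [hr]
      simp only [Nat.add_sub_cancel]
      ring
  have hgr : IsGreatest {N | ∃ f : MvPolynomial (Fin (n+1+1)) F,
    f ≠ 0 ∧ MvPolynomial.IsWeightedHomogeneous w f d ∧ N = (vanishSet F w f).ncard} ((κ+1) * q^n + pSum q n) := by
    constructor
    · obtain ⟨f, h0, hf, hz⟩ := lower w hw0 d κ (min_le_right _ _) (by
        have h1 : κ * w 1 ≤ k * w 1 := Nat.mul_le_mul_right _ (min_le_left _ _)
        have h2 : k * w 1 ≤ d - 1 := Nat.div_mul_le_self _ _
        omega)
      refine ⟨f, h0, hf, le_antisymm ?_ (hub f h0 hf)⟩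
      apply hle
      rw [hR2, vanish_card w hpos f d hd hf]
      exact hz
    · rintro N ⟨f, h0, hf, rfl⟩
      exact hub f h0 hf
  exact hgr.csSup_eq

end
end

section
/- Fix 1 ≤ d ≤ w_1 q and let μ = x_0^{a_0} ⋯ x_m^{a_m} ∈ M̄_{d, 0} (so a_0 ≥ 1). Set d_1 = ⌊(d−1)/w_1⌋ and let a_0* = d − d_1 w_1 (so 1 ≤ a_0* ≤ w_1). Then FB(μ) ≥ FB( x_0^{a_0*} x_1^{d_1} ) = q^{m−1} · ( q − d_1 ). In particular, if w_1 ∣ d this reads FB(μ) ≥ FB( x_0^{w_1} x_1^{d/w_1 − 1} ) = q^{m−1}(q − d/w_1 + 1). -/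
open MvPolynomial

noncomputable section

theorem aux_rel_symm {F : Type} [Field F] {m : ℕ} {w : Fin (m + 1) → ℕ}
    {x y : {v : Fin (m + 1) → AlgebraicClosure F // v ≠ 0}} (h : wRel F w x y) :
    wRel F w y x := by
  obtain ⟨l, hl⟩ := h
  refine ⟨l⁻¹, fun i => ?_⟩
  rw [hl i, ← mul_assoc, ← mul_pow]
  simp

theorem aux_rel_trans {F : Type} [Field F] {m : ℕ} {w : Fin (m + 1) → ℕ}
    {x y z : {v : Fin (m + 1) → AlgebraicClosure F // v ≠ 0}} (h : wRel F w x y)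
    (h' : wRel F w y z) : wRel F w x z := by
  obtain ⟨l, hl⟩ := h
  obtain ⟨k, hk⟩ := h'
  refine ⟨k * l, fun i => ?_⟩
  rw [hk i, hl i, Units.val_mul, mul_pow, mul_assoc]

theorem aux_rel_of_eq {F : Type} [Field F] {m : ℕ} {w : Fin (m + 1) → ℕ}
    {x y : {v : Fin (m + 1) → AlgebraicClosure F // v ≠ 0}} (h : PW.mk F w x = PW.mk F w y) :
    wRel F w x y := by
  have := Quot.eqvGen_exact h
  induction this with
  | rel _ _ h1 => exact h1
  | refl x => exact ⟨1, by simp⟩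
  | symm _ _ h1 ih => exact aux_rel_symm (ih (Quot.eqvGen_sound h1))
  | trans _ _ _ h1 h2 ih1 ih2 =>
    exact aux_rel_trans (ih1 (Quot.eqvGen_sound h1)) (ih2 (Quot.eqvGen_sound h2))

/-- Every representative of a rational point is fixed by Frobenius up to scaling. -/
theorem aux_rat {F : Type} [Field F] [Fintype F] {m : ℕ} {w : Fin (m + 1) → ℕ}
    {x : {v : Fin (m + 1) → AlgebraicClosure F // v ≠ 0}} {c : PW F w}
    (hc : c ∈ ratPts F w) (hx : PW.mk F w x = c) :
    ∃ l : AlgebraicClosure F, ∀ i, x.1 i ^ Fintype.card F = l ^ w i * x.1 i := by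
  obtain ⟨y, hy, h0, hy2⟩ := hc
  obtain ⟨s, hs⟩ := aux_rel_of_eq (hx.trans hy.symm)
  obtain ⟨t, ht⟩ := aux_rel_of_eq (hy.trans hy2.symm)
  refine ⟨(s⁻¹ : (AlgebraicClosure F)ˣ) ^ Fintype.card F * t * s, fun i => ?_⟩
  have h1 := ht i
  simp only at h1
  rw [hs i] at h1
  have h2 : ((s⁻¹ : (AlgebraicClosure F)ˣ) : AlgebraicClosure F) * s = 1 := by simp
  calc x.1 i ^ Fintype.card F
      = (((s⁻¹ : (AlgebraicClosure F)ˣ) : AlgebraicClosure F) * s) ^ (w i * Fintype.card F)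
          * x.1 i ^ Fintype.card F := by rw [h2]; simp
    _ = ((s⁻¹ : (AlgebraicClosure F)ˣ) : AlgebraicClosure F) ^ (w i * Fintype.card F) *
          ((s : AlgebraicClosure F) ^ w i * x.1 i) ^ Fintype.card F := by ring
    _ = _ := by rw [h1]; ring

theorem aux_wdeg {m : ℕ} (w : Fin (m + 1) → ℕ) (a : Fin (m + 1) →₀ ℕ) :
    Finsupp.weight w a = wdeg w a := by
  rw [Finsupp.weight_apply, Finsupp.sum_fintype _ _ (by simp)]
  simp [wdeg, mul_comm]

/-- Monomials of `Mbar` divisible by `x_0` have the other exponents below `q`. -/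
theorem aux_lt {F : Type} [Field F] [Fintype F] {m : ℕ} {w : Fin (m + 1) → ℕ}
    (hw0 : w 0 = 1) {b : Fin (m + 1) →₀ ℕ} (hb : b ∈ Mbar F w) (hb0 : 1 ≤ b 0)
    (i : Fin (m + 1)) (hi : i ≠ 0) : b i < Fintype.card F := by
  by_contra hcon
  push Not at hcon
  apply hb
  have hq : 1 < Fintype.card F := Fintype.one_lt_card
  obtain ⟨r, hr⟩ : ∃ r, Fintype.card F = r + 1 := ⟨_, (Nat.sub_add_cancel hq.le).symm⟩
  set u : Fin (m + 1) →₀ ℕ := Finsupp.single 0 1 + Finsupp.single i (Fintype.card F) with hu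
  set v : Fin (m + 1) →₀ ℕ := Finsupp.single 0 (1 + w i * r) + Finsupp.single i 1 with hv
  have hui : u i = Fintype.card F := by simp [hu, hi]
  have hvi : v i = 1 := by simp [hv, hi]
  have huv : u ≠ v := fun h => by
    have := DFunLike.congr_fun h i
    omega
  have hdu : wdeg w u = 1 + w i * Fintype.card F := by
    rw [← aux_wdeg, hu, map_add, Finsupp.weight_single, Finsupp.weight_single, hw0]
    simp [mul_comm]
  have hdv : wdeg w v = 1 + w i * Fintype.card F := by
    rw [← aux_wdeg, hv, map_add, Finsupp.weight_single, Finsupp.weight_single, hw0, hr]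
    simp only [smul_eq_mul]
    ring
  set g : MvPolynomial (Fin (m + 1)) F := monomial u 1 - monomial v 1 with hg
  have hcoef : ∀ e, coeff e g = (if u = e then 1 else 0) - (if v = e then 1 else 0) := by
    intro e
    simp [hg, coeff_monomial]
  have hgu : coeff u g = 1 := by rw [hcoef]; simp [huv.symm]
  have hhom : IsWeightedHomogeneous w g (1 + w i * Fintype.card F) := by
    apply Submodule.sub_mem (weightedHomogeneousSubmodule F w (1 + w i * Fintype.card F))
    · exact isWeightedHomogeneous_monomial w u 1 (by rw [aux_wdeg, hdu])
    · exact isWeightedHomogeneous_monomial w v 1 (by rw [aux_wdeg, hdv])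
  refine ⟨g, ?_, ?_, ⟨_, hhom⟩, u, ⟨?_, ?_⟩, ?_⟩
  · intro h
    rw [h] at hgu
    simp at hgu
  · apply Ideal.subset_span
    refine ⟨⟨_, hhom⟩, fun c hc x hx => ?_⟩
    obtain ⟨l, hl⟩ := aux_rat hc hx
    have e1 : eval x.1 (map (algebraMap F (AlgebraicClosure F)) g) =
        x.1 0 * x.1 i ^ Fintype.card F - x.1 0 * (x.1 0 ^ r) ^ w i * x.1 i := by
      simp only [hg, hu, hv, map_sub, map_monomial, map_one, eval_monomial, one_mul]
      rw [Finsupp.prod_add_index' (by simp) (by intros; rw [pow_add]),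
        Finsupp.prod_add_index' (by simp) (by intros; rw [pow_add])]
      simp only [Finsupp.prod_single_index, pow_zero]
      ring
    rw [e1]
    by_cases h0 : x.1 0 = 0
    · simp [h0]
    · have h1 := hl 0
      rw [hw0, hr, pow_succ, pow_one] at h1
      have h2 := mul_right_cancel₀ h0 h1
      rw [hl i, h2]
      ring
  · rw [mem_support_iff, hgu]; exact one_ne_zero
  · intro e he hne
    have : e = v := by
      by_contra h
      rw [mem_support_iff, hcoef, if_neg (Ne.symm hne), if_neg (Ne.symm h)] at he
      simp at he
    subst this
    refine Or.inr ⟨by rw [hdu, hdv], i, by omega, fun j hj => ?_⟩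
    have hj0 : j ≠ 0 := by
      intro h; subst h; exact absurd hj (by simp)
    rw [hu, hv]
    simp [hj0, hj.ne']
  · intro j
    by_cases hj0 : j = 0
    · subst hj0; simpa [hu, hi] using hb0
    · by_cases hji : j = i
      · subst hji; omega
      · simp [hu, hj0, hji]

/-- Reduced monomials lie in `Mbar`. -/
theorem aux_mem {F : Type} [Field F] [Fintype F] {m : ℕ} {w : Fin (m + 1) → ℕ}
    (hw0 : w 0 = 1) {b : Fin (m + 1) →₀ ℕ}
    (hb : ∀ i, i ≠ 0 → b i < Fintype.card F) : b ∈ Mbar F w := by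
  classical
  rintro ⟨g, hg0, hgI, ⟨e, he⟩, c, ⟨hc, hcm⟩, hcb⟩
  have hcq : ∀ i, i ≠ 0 → c i < Fintype.card F := fun i hi => (hcb i).trans_lt (hb i hi)
  have hvan : ∀ x : Fin (m + 1) → F, x 0 = 1 → eval x g = 0 := by
    intro x hx
    set X : Fin (m + 1) → AlgebraicClosure F := fun i => algebraMap F _ (x i) with hX
    have hX0 : X ≠ 0 := fun h => by
      have := congrFun h 0
      simp [hX, hx] at this
    have hle : vanishingIdeal F w ≤
        RingHom.ker ((eval X).comp (map (algebraMap F (AlgebraicClosure F)))) := by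
      apply Ideal.span_le.mpr
      rintro f ⟨-, hf⟩
      have hfr : (fun i => X i ^ Fintype.card F) = X := by
        funext i
        simp only [hX]
        rw [← map_pow, FiniteField.pow_card]
      refine hf (PW.mk F w ⟨X, hX0⟩) ⟨⟨X, hX0⟩, rfl, ?_, ?_⟩ ⟨X, hX0⟩ rfl
      · simpa only [hfr] using hX0
      · simp only [hfr]
    have h1 := hle hgI
    rw [RingHom.mem_ker, RingHom.comp_apply, eval_map] at h1
    have h2 : eval₂ (algebraMap F (AlgebraicClosure F)) X g
        = algebraMap F (AlgebraicClosure F) (eval x g) := by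
      rw [hX]
      exact (eval₂_comp_left (algebraMap F (AlgebraicClosure F)) (RingHom.id F) x g).symm
    rw [h2] at h1
    exact (map_eq_zero _).mp h1
  set t : Fin (m + 1) → Finset F := fun i => if i = 0 then {1} else Finset.univ with ht
  set k : Fin (m + 1) → ℕ := fun i => Fintype.card F - 1 - c i with hk
  have hS : ∑ x ∈ Fintype.piFinset t, (∏ i, x i ^ k i) * eval x g = 0 := by
    apply Finset.sum_eq_zero
    intro x hx
    have := Fintype.mem_piFinset.mp hx 0
    rw [hvan x (by simpa [ht] using this), mul_zero]
  have hS2 : ∑ x ∈ Fintype.piFinset t, (∏ i, x i ^ k i) * eval x g =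
      ∑ s ∈ g.support, coeff s g * ∏ i, ∑ y ∈ t i, y ^ (k i + s i) := by
    simp_rw [eval_eq', Finset.mul_sum]
    rw [Finset.sum_comm]
    apply Finset.sum_congr rfl
    intro s _
    rw [Finset.prod_univ_sum, Finset.mul_sum]
    apply Finset.sum_congr rfl
    intro x _
    simp_rw [pow_add]
    rw [Finset.prod_mul_distrib]
    ring
  rw [hS2, Finset.sum_eq_single_of_mem c hc] at hS
  · have hcc := mem_support_iff.mp hc
    rcases mul_eq_zero.mp hS with h | h
    · exact hcc h
    · obtain ⟨i, -, hi⟩ := Finset.prod_eq_zero_iff.mp h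
      by_cases hi0 : i = 0
      · simp [ht, hi0] at hi
      · have hq : 1 < Fintype.card F := Fintype.one_lt_card
        have h1 : k i + c i = Fintype.card F - 1 := by
          have := hcq i hi0
          simp only [hk]; omega
        rw [h1] at hi
        simp only [ht, if_neg hi0] at hi
        have h3 : ∀ y : F, y ^ (Fintype.card F - 1) = if y = 0 then 0 else 1 := by
          intro y
          split_ifs with hy
          · rw [hy, zero_pow (by omega)]
          · exact FiniteField.pow_card_sub_one_eq_one y hy
        simp_rw [h3] at hi
        have h4 : ∑ y : F, (if y = 0 then (0 : F) else 1) = ∑ y : F, (1 - if y = 0 then 1 else 0) :=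
          Finset.sum_congr rfl (fun y _ => by split_ifs <;> simp)
        rw [h4, Finset.sum_sub_distrib] at hi
        simp at hi
  · intro s hs hsc
    have hd : wdeg w s = wdeg w c := by
      rw [← aux_wdeg, ← aux_wdeg, he (mem_support_iff.mp hs), he (mem_support_iff.mp hc)]
    rcases hcm s hs hsc with h | ⟨-, i, hi, hij⟩
    · omega
    · have hi0 : i ≠ 0 := by
        intro h0
        subst h0
        unfold wdeg at hd
        rw [Fin.sum_univ_succ, Fin.sum_univ_succ, hw0] at hd
        have : ∑ j : Fin m, w j.succ * s j.succ = ∑ j : Fin m, w j.succ * c j.succ :=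
          Finset.sum_congr rfl (fun j _ => by rw [hij _ (Fin.succ_pos j)])
        omega
      rw [Finset.prod_eq_zero (Finset.mem_univ i), mul_zero]
      simp only [ht, if_neg hi0]
      apply FiniteField.sum_pow_lt_card_sub_one
      have := hcq i hi0
      simp only [hk]; omega

/-- Closed form of the footprint bound for monomials divisible by `x_0`. -/
theorem aux_FB {F : Type} [Field F] [Fintype F] {m : ℕ} {w : Fin (m + 1) → ℕ}
    (hw0 : w 0 = 1) {a : Fin (m + 1) →₀ ℕ} (ha0 : 1 ≤ a 0) (D : ℕ)
    (hD : a 0 + ∑ i : Fin m, w i.succ * Fintype.card F ≤ D) :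
    FB F w D a = ∏ i : Fin m, (Fintype.card F - a i.succ) := by
  classical
  set P := Fintype.piFinset (fun i : Fin m => Finset.Ico (a i.succ) (Fintype.card F)) with hP
  set f : (Fin m → ℕ) → (Fin (m + 1) →₀ ℕ) := fun p =>
    Finsupp.equivFunOnFinite.symm
      (Fin.cons (D - ∑ i : Fin m, w i.succ * p i) p : Fin (m + 1) → ℕ) with hf
  have hf0 : ∀ p, f p 0 = D - ∑ i : Fin m, w i.succ * p i := fun p => by simp [hf]
  have hfs : ∀ p (i : Fin m), f p i.succ = p i := fun p i => by simp [hf]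
  have hfinj : Function.Injective f := by
    intro p p' h
    funext i
    rw [← hfs p i, ← hfs p' i, h]
  have key : {b | b ∈ MbarD F w D ∧ a ≤ b} = f '' (P : Set (Fin m → ℕ)) := by
    ext b
    constructor
    · rintro ⟨⟨hb, hbD⟩, hab⟩
      refine ⟨fun i => b i.succ, ?_, ?_⟩
      · rw [Finset.mem_coe, hP, Fintype.mem_piFinset]
        intro i
        rw [Finset.mem_Ico]
        exact ⟨hab _, aux_lt hw0 hb (ha0.trans (hab 0)) _ (Fin.succ_ne_zero i)⟩
      · ext j
        refine Fin.cases ?_ (fun i => hfs _ i) j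
        rw [hf0]
        unfold wdeg at hbD
        rw [Fin.sum_univ_succ, hw0] at hbD
        omega
    · rintro ⟨p, hp, rfl⟩
      rw [Finset.mem_coe, hP, Fintype.mem_piFinset] at hp
      simp only [Finset.mem_Ico] at hp
      have hle : ∑ i : Fin m, w i.succ * p i ≤ ∑ i : Fin m, w i.succ * Fintype.card F :=
        Finset.sum_le_sum (fun i _ => Nat.mul_le_mul_left _ (hp i).2.le)
      refine ⟨⟨aux_mem hw0 ?_, ?_⟩, ?_⟩
      · intro i hi
        obtain ⟨j, rfl⟩ := Fin.exists_succ_eq.mpr hi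
        rw [hfs]
        exact (hp j).2
      · unfold wdeg
        rw [Fin.sum_univ_succ, hw0, hf0]
        simp_rw [hfs]
        omega
      · intro j
        refine Fin.cases ?_ (fun i => ?_) j
        · rw [hf0]; omega
        · rw [hfs]; exact (hp i).1
  unfold FB
  rw [key, Set.ncard_image_of_injective _ hfinj, Set.ncard_coe_finset, hP,
    Fintype.card_piFinset]
  simp

theorem aux_prod {ι : Type} (s : Finset ι) (q : ℕ) (c : ι → ℕ) (hc : ∀ i ∈ s, c i ≤ q) :
    q ^ s.card ≤ ∏ i ∈ s, (q - c i) + (∑ i ∈ s, c i) * q ^ (s.card - 1) := by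
  classical
  induction s using Finset.induction_on with
  | empty => simp
  | insert j s hj ih =>
    have ih := ih (fun i hi => hc i (Finset.mem_insert_of_mem hi))
    have hcj := hc j (Finset.mem_insert_self _ _)
    rw [Finset.prod_insert hj, Finset.sum_insert hj, Finset.card_insert_of_notMem hj,
      Nat.add_sub_cancel]
    obtain ⟨r, hr⟩ := Nat.exists_eq_add_of_le hcj
    have hrq : q - c j = r := by omega
    rw [hrq]
    have h1 : (∑ i ∈ s, c i) * q ^ (s.card - 1) * r ≤ (∑ i ∈ s, c i) * q ^ s.card := by
      rcases s.eq_empty_or_nonempty with h | h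
      · simp [h]
      · have hcard := h.card_pos
        calc (∑ i ∈ s, c i) * q ^ (s.card - 1) * r
            ≤ (∑ i ∈ s, c i) * q ^ (s.card - 1) * q := Nat.mul_le_mul_left _ (by omega)
          _ = (∑ i ∈ s, c i) * q ^ (s.card - 1 + 1) := by rw [pow_succ, mul_assoc]
          _ = _ := by rw [Nat.sub_add_cancel hcard]
    have h2 : q ^ (s.card + 1) = q ^ s.card * r + c j * q ^ s.card := by
      rw [pow_succ]; nth_rewrite 2 [hr]; ring
    nlinarith [Nat.mul_le_mul_right r ih]

/-- Lemma 3.1 of the paper: minimality of the footprint bound over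
monomials of `M̄_{d,0}`, attained at `x_0^{a_0*} x_1^{d_1}`. -/
theorem stmt8 (F : Type) [Field F] [Fintype F] (m ℓ : ℕ) (w : Fin (m + 1) → ℕ)
    (hℓ1 : 1 ≤ ℓ) (hℓm : ℓ + 1 ≤ m)
    (hpos : ∀ i, 1 ≤ w i)
    (hw0 : w ⟨0, by omega⟩ = 1)
    (hweq : ∀ i : Fin (m + 1), 1 ≤ (i : ℕ) → (i : ℕ) ≤ ℓ → w i = w ⟨1, by omega⟩)
    (hlt : w ⟨ℓ, by omega⟩ < w ⟨ℓ + 1, by omega⟩)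
    (hmono : ∀ i j : Fin (m + 1), ℓ + 1 ≤ (i : ℕ) → i ≤ j → w i ≤ w j)
    (d : ℕ) (hd1 : 1 ≤ d) (hdq : d ≤ w ⟨1, by omega⟩ * Fintype.card F)
    (a : Fin (m + 1) →₀ ℕ) (ha : a ∈ MbarDI F w d ⟨0, by omega⟩)
    (d1 a0s : ℕ) (hd1def : d1 = (d - 1) / w ⟨1, by omega⟩)
    (ha0s : a0s = d - d1 * w ⟨1, by omega⟩) :
    ∃ N : ℕ, ∀ dtil ∈ regSet F w, N ≤ dtil →
      FB F w dtil
          (Finsupp.single ⟨0, by omega⟩ a0s + Finsupp.single ⟨1, by omega⟩ d1) =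
        Fintype.card F ^ (m - 1) * (Fintype.card F - d1) ∧
      FB F w dtil
          (Finsupp.single ⟨0, by omega⟩ a0s + Finsupp.single ⟨1, by omega⟩ d1) ≤
        FB F w dtil a := by
  have hq : 1 < Fintype.card F := Fintype.one_lt_card
  obtain ⟨n, rfl⟩ : ∃ n, m = n + 1 := ⟨m - 1, by omega⟩
  have e1 : (⟨1, by omega⟩ : Fin (n + 1 + 1)) = Fin.succ 0 := rfl
  have e0 : (⟨0, by omega⟩ : Fin (n + 1 + 1)) = 0 := rfl
  rw [e0] at hw0 ha
  simp only [e0, e1] at *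
  obtain ⟨⟨haM, had⟩, -, ha0⟩ := ha
  have hW : 1 ≤ w (Fin.succ 0) := hpos _
  have hwge : ∀ i : Fin (n + 1), w (Fin.succ 0) ≤ w i.succ := by
    intro i
    by_cases hi : (i.succ : ℕ) ≤ ℓ
    · exact (hweq i.succ (by simp) hi).ge
    · have h1 := hweq ⟨ℓ, by omega⟩ hℓ1 le_rfl
      have h2 := hmono ⟨ℓ + 1, by omega⟩ i.succ le_rfl (by rw [Fin.le_def]; simp only; omega)
      omega
  have hd1w : d1 * w (Fin.succ 0) ≤ d - 1 := by
    rw [hd1def]; exact Nat.div_mul_le_self _ _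
  have ha0s1 : 1 ≤ a0s := by omega
  have hd1q : d1 < Fintype.card F := by
    rw [hd1def, Nat.div_lt_iff_lt_mul hW, mul_comm]; omega
  have hsum : ∑ i : Fin (n + 1), a i.succ ≤ d1 := by
    rw [hd1def, Nat.le_div_iff_mul_le hW, Finset.sum_mul]
    unfold wdeg at had
    rw [Fin.sum_univ_succ, hw0] at had
    have : ∑ i : Fin (n + 1), a i.succ * w (Fin.succ 0)
        ≤ ∑ i : Fin (n + 1), w i.succ * a i.succ :=
      Finset.sum_le_sum (fun i _ => by rw [mul_comm]; exact Nat.mul_le_mul_right _ (hwge i))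
    omega
  refine ⟨a 0 + a0s + ∑ i : Fin (n + 1), w i.succ * Fintype.card F, fun D _ hD => ?_⟩
  have hA := aux_FB (F := F) hw0 ha0 D (by omega)
  set s : Fin (n + 1 + 1) →₀ ℕ := Finsupp.single 0 a0s + Finsupp.single (Fin.succ 0) d1 with hs
  have hs0 : s 0 = a0s := by simp [hs]
  have hB := aux_FB (F := F) (a := s) hw0 (by omega) D (by omega)
  have hs1 : s (Fin.succ 0) = d1 := by simp [hs]
  have hs2 : ∀ i : Fin n, s i.succ.succ = 0 := fun i => by
    rw [hs, Finsupp.add_apply, Finsupp.single_eq_of_ne (Fin.succ_ne_zero _),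
      Finsupp.single_eq_of_ne (fun h => Fin.succ_ne_zero _ (Fin.succ_injective _ h)), add_zero]
  have hB' : FB F w D s = Fintype.card F ^ n * (Fintype.card F - d1) := by
    rw [hB, Fin.prod_univ_succ, hs1]
    simp_rw [hs2]
    simp [mul_comm]
  refine ⟨hB', ?_⟩
  rw [hB', hA]
  have hp := aux_prod Finset.univ (Fintype.card F) (fun i : Fin (n + 1) => a i.succ)
    (fun i _ => (aux_lt hw0 haM ha0 _ (Fin.succ_ne_zero i)).le)
  simp only [Finset.card_univ, Fintype.card_fin, Nat.add_sub_cancel] at hp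
  have h3 := Nat.mul_le_mul_right (Fintype.card F ^ n) hsum
  rw [Nat.mul_sub, ← pow_succ, mul_comm _ d1]
  omega


end
end
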